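/- arXiv:2205.12499 — 7 statements merged into one kernel-verified Lean document; each statement's English description precedes it below -/
import Mathlib

section
/- Let Λ, Ω, a, b, c be C¹ functions of (x,y) on an open set U ⊂ ℝ², with Λ > 0 on U. Set H(x,y,p₁,p₂) = (p₁² + p₂²)/(2Λ(x,y)) and F(x,y,p₁,p₂) = a(x,y)p₁ + b(x,y)p₂ + c(x,y). Then {F,H}_mg vanishes identically on U × ℝ² if and only if the following five equations hold identically on U: a_x = b_y, a_y = −b_x, (aΛ)_x + (bΛ)_y = 0, c_x = bΩ, and c_y = −aΩ. -/
open Real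

/-- Partial derivative in the first variable of a function on `ℝ²`. -/
noncomputable def pdx (f : ℝ × ℝ → ℝ) (p : ℝ × ℝ) : ℝ := deriv (fun t => f (t, p.2)) p.1

/-- Partial derivative in the second variable of a function on `ℝ²`. -/
noncomputable def pdy (f : ℝ × ℝ → ℝ) (p : ℝ × ℝ) : ℝ := deriv (fun t => f (p.1, t)) p.2

/-- The magnetic Poisson bracket of two functions `F`, `H` of `(x, y, p₁, p₂)` with
magnetic field `Ω(x,y)`. -/
noncomputable def magneticBracket (Ω : ℝ → ℝ → ℝ) (F H : ℝ → ℝ → ℝ → ℝ → ℝ)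
    (x y p₁ p₂ : ℝ) : ℝ :=
  deriv (fun t => F t y p₁ p₂) x * deriv (fun t => H x y t p₂) p₁
    - deriv (fun t => F x y t p₂) p₁ * deriv (fun t => H t y p₁ p₂) x
    + deriv (fun t => F x t p₁ p₂) y * deriv (fun t => H x y p₁ t) p₂
    - deriv (fun t => F x y p₁ t) p₂ * deriv (fun t => H x t p₁ p₂) y
    + Ω x y * (deriv (fun t => F x y t p₂) p₁ * deriv (fun t => H x y p₁ t) p₂
      - deriv (fun t => F x y p₁ t) p₂ * deriv (fun t => H x y t p₂) p₁)

theorem hasDerivAt_pdx {f : ℝ × ℝ → ℝ} {x y : ℝ} (hf : DifferentiableAt ℝ f (x, y)) :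
    HasDerivAt (fun t => f (t, y)) (pdx f (x, y)) x :=
  (DifferentiableAt.comp (g := f) (f := fun t : ℝ => (t, y)) x hf (by fun_prop)).hasDerivAt

theorem hasDerivAt_pdy {f : ℝ × ℝ → ℝ} {x y : ℝ} (hf : DifferentiableAt ℝ f (x, y)) :
    HasDerivAt (fun t => f (x, t)) (pdy f (x, y)) y :=
  (DifferentiableAt.comp (g := f) (f := fun t : ℝ => (x, t)) y hf (by fun_prop)).hasDerivAt

theorem pdx_mul {f g : ℝ × ℝ → ℝ} {x y : ℝ} (hf : DifferentiableAt ℝ f (x, y))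
    (hg : DifferentiableAt ℝ g (x, y)) :
    pdx (fun q => f q * g q) (x, y) = pdx f (x, y) * g (x, y) + f (x, y) * pdx g (x, y) :=
  ((hasDerivAt_pdx hf).mul (hasDerivAt_pdx hg)).deriv

theorem pdy_mul {f g : ℝ × ℝ → ℝ} {x y : ℝ} (hf : DifferentiableAt ℝ f (x, y))
    (hg : DifferentiableAt ℝ g (x, y)) :
    pdy (fun q => f q * g q) (x, y) = pdy f (x, y) * g (x, y) + f (x, y) * pdy g (x, y) :=
  ((hasDerivAt_pdy hf).mul (hasDerivAt_pdy hg)).deriv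

theorem HasDerivAt.const_div_two_mul {f : ℝ → ℝ} {f' t : ℝ} (hf : HasDerivAt f f' t)
    (h0 : f t ≠ 0) (k : ℝ) :
    HasDerivAt (fun s => k / (2 * f s)) (-(k * f') / (2 * f t ^ 2)) t := by
  refine ((hasDerivAt_const t k).fun_div (hf.const_mul 2)
    (mul_ne_zero two_ne_zero h0)).congr_deriv ?_
  field_simp
  ring

/-- The bracket of a function linear in the momenta with the kinetic energy of the conformal
metric `Λ (dx² + dy²)`, as an explicit polynomial in the momenta. -/
theorem magneticBracket_linear {Λ Ω a b c : ℝ × ℝ → ℝ} {x y : ℝ}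
    (hΛ : DifferentiableAt ℝ Λ (x, y)) (ha : DifferentiableAt ℝ a (x, y))
    (hb : DifferentiableAt ℝ b (x, y)) (hc : DifferentiableAt ℝ c (x, y))
    (h0 : Λ (x, y) ≠ 0) (p₁ p₂ : ℝ) :
    magneticBracket (fun x y => Ω (x, y))
        (fun x y p₁ p₂ => a (x, y) * p₁ + b (x, y) * p₂ + c (x, y))
        (fun x y p₁ p₂ => (p₁ ^ 2 + p₂ ^ 2) / (2 * Λ (x, y))) x y p₁ p₂ =
      (2 * Λ (x, y) * ((pdx a (x, y) * p₁ + pdx b (x, y) * p₂ + pdx c (x, y)) * p₁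
          + (pdy a (x, y) * p₁ + pdy b (x, y) * p₂ + pdy c (x, y)) * p₂
          + Ω (x, y) * (a (x, y) * p₂ - b (x, y) * p₁))
        + (p₁ ^ 2 + p₂ ^ 2) * (a (x, y) * pdx Λ (x, y) + b (x, y) * pdy Λ (x, y)))
      / (2 * Λ (x, y) ^ 2) := by
  have hFx := (((hasDerivAt_pdx ha).mul_const p₁).fun_add
    ((hasDerivAt_pdx hb).mul_const p₂)).fun_add (hasDerivAt_pdx hc)
  have hFy := (((hasDerivAt_pdy ha).mul_const p₁).fun_add
    ((hasDerivAt_pdy hb).mul_const p₂)).fun_add (hasDerivAt_pdy hc)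
  have hF₁ := ((((hasDerivAt_id' p₁).const_mul (a (x, y))).add_const
    (b (x, y) * p₂)).add_const (c (x, y)))
  have hF₂ := ((((hasDerivAt_id' p₂).const_mul (b (x, y))).const_add
    (a (x, y) * p₁)).add_const (c (x, y)))
  have hHx := (hasDerivAt_pdx hΛ).const_div_two_mul h0 (p₁ ^ 2 + p₂ ^ 2)
  have hHy := (hasDerivAt_pdy hΛ).const_div_two_mul h0 (p₁ ^ 2 + p₂ ^ 2)
  have hH₁ := ((hasDerivAt_pow 2 p₁).add_const (p₂ ^ 2)).div_const (2 * Λ (x, y))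
  have hH₂ := ((hasDerivAt_pow 2 p₂).const_add (p₁ ^ 2)).div_const (2 * Λ (x, y))
  simp only [magneticBracket]
  rw [hFx.deriv, hFy.deriv, hF₁.deriv, hF₂.deriv, hHx.deriv, hHy.deriv, hH₁.deriv, hH₂.deriv]
  field_simp
  push_cast
  ring

/-- For `C¹` functions `Λ, Ω, a, b, c` on an open set `U ⊂ ℝ²` with `Λ > 0`,
the linear function `F = a p₁ + b p₂ + c` satisfies `{F,H}_mg ≡ 0` on `U × ℝ²` for
`H = (p₁² + p₂²)/(2Λ)` if and only if the equations
`a_x = b_y`, `a_y = −b_x`, `(aΛ)_x + (bΛ)_y = 0`, `c_x = bΩ`, `c_y = −aΩ` hold on `U`. -/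
theorem statement2 (U : Set (ℝ × ℝ)) (hU : IsOpen U)
    (Λ Ω a b c : ℝ × ℝ → ℝ)
    (hΛ : ContDiffOn ℝ 1 Λ U) (hΩ : ContDiffOn ℝ 1 Ω U)
    (ha : ContDiffOn ℝ 1 a U) (hb : ContDiffOn ℝ 1 b U) (hc : ContDiffOn ℝ 1 c U)
    (hΛpos : ∀ p ∈ U, 0 < Λ p) :
    (∀ x y p₁ p₂ : ℝ, (x, y) ∈ U →
        magneticBracket (fun x y => Ω (x, y))
          (fun x y p₁ p₂ => a (x, y) * p₁ + b (x, y) * p₂ + c (x, y))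
          (fun x y p₁ p₂ => (p₁ ^ 2 + p₂ ^ 2) / (2 * Λ (x, y))) x y p₁ p₂ = 0)
      ↔ (∀ p ∈ U,
          pdx a p = pdy b p ∧
          pdy a p = -pdx b p ∧
          pdx (fun q => a q * Λ q) p + pdy (fun q => b q * Λ q) p = 0 ∧
          pdx c p = b p * Ω p ∧
          pdy c p = -(a p * Ω p)) := by
  have hd {f : ℝ × ℝ → ℝ} (hf : ContDiffOn ℝ 1 f U) {p : ℝ × ℝ} (hp : p ∈ U) :
      DifferentiableAt ℝ f p :=
    (hf.differentiableOn one_ne_zero).differentiableAt (hU.mem_nhds hp)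
  have key : ∀ x y p₁ p₂ : ℝ, (x, y) ∈ U → _ := fun x y p₁ p₂ h =>
    magneticBracket_linear (Ω := Ω) (hd hΛ h) (hd ha h) (hd hb h) (hd hc h) (hΛpos _ h).ne' p₁ p₂
  constructor
  · rintro h ⟨x, y⟩ hp
    have hpos := hΛpos _ hp
    have hne : 2 * Λ (x, y) ≠ 0 := by positivity
    have hQ (p₁ p₂ : ℝ) := (div_eq_zero_iff.1 ((key x y p₁ p₂ hp).symm.trans
      (h x y p₁ p₂ hp))).resolve_right (by positivity)
    rw [pdx_mul (hd ha hp) (hd hΛ hp), pdy_mul (hd hb hp) (hd hΛ hp)]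
    have e₁ := hQ 1 0
    have e₂ := hQ (-1) 0
    have e₃ := hQ 0 1
    have e₄ := hQ 0 (-1)
    have e₅ := hQ 1 1
    refine ⟨?_, ?_, ?_, ?_, ?_⟩
    · apply mul_left_cancel₀ hne
      linear_combination (e₁ + e₂ - e₃ - e₄) / 2
    · apply mul_left_cancel₀ hne
      linear_combination e₅ - e₁ - e₃
    · linear_combination (e₁ + e₂ + e₃ + e₄) / 4
    · apply mul_left_cancel₀ hne
      linear_combination (e₁ - e₂) / 2
    · apply mul_left_cancel₀ hne
      linear_combination (e₃ - e₄) / 2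
  · intro h x y p₁ p₂ hp
    obtain ⟨h₁, h₂, h₃, h₄, h₅⟩ := h _ hp
    rw [pdx_mul (hd ha hp) (hd hΛ hp), pdy_mul (hd hb hp) (hd hΛ hp)] at h₃
    rw [key x y p₁ p₂ hp, div_eq_zero_iff]
    left
    linear_combination (p₁ ^ 2 + p₂ ^ 2) * h₃ + Λ (x, y) * (p₁ ^ 2 - p₂ ^ 2) * h₁
      + 2 * Λ (x, y) * (p₁ * p₂ * h₂ + p₁ * h₄ + p₂ * h₅)
end

section
/- Let γ, δ, ε, ζ be real constants with ζ ≠ 0, and let ∛ denote the real cube root. On the open set U = {(x,y) ∈ ℝ² : (2x+δ)² + (2y+γ)² ≠ 0}, define Λ(x,y) = −(1/(2ζ))·∛(ζ((2x+δ)² + (2y+γ)²)), u₀(x,y) = 4ε/ζ, f(x,y) = (2y+γ)/∛(ζ((2y+γ)² + (2x+δ)²)), and g(x,y) = −(2x+δ)/∛(ζ((2y+γ)² + (2x+δ)²)). Then (Λ, u₀, f, g) satisfies the quasi-linear system (4.1) on U, and the associated magnetic field Ω = (g_x − f_y)/4 equals Ω(x,y) = −2/(3·∛(ζ((2x+δ)²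 + (2y+γ)²))). -/
open Real

/-- The real cube root: the unique real number whose cube is `t`. -/
noncomputable def cbrt (t : ℝ) : ℝ := Real.sign t * |t| ^ ((1 : ℝ) / 3)

lemma cbrt_of_pos {t : ℝ} (ht : 0 < t) : cbrt t = t ^ ((1 : ℝ) / 3) := by
  simp [cbrt, Real.sign_of_pos ht, abs_of_pos ht]

lemma cbrt_neg (t : ℝ) : cbrt (-t) = -cbrt t := by
  simp [cbrt, Real.sign_neg]

lemma cbrt_pow_three (t : ℝ) : cbrt t ^ 3 = t := by
  have key : ∀ s : ℝ, 0 < s → cbrt s ^ 3 = s := fun s hs => by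
    rw [cbrt_of_pos hs, ← Real.rpow_natCast, ← Real.rpow_mul hs.le]
    norm_num
  rcases lt_trichotomy t 0 with ht | rfl | ht
  · have h := key (-t) (neg_pos.2 ht)
    rw [cbrt_neg] at h
    linear_combination -h
  · simp [cbrt]
  · exact key t ht

lemma cbrt_ne_zero {t : ℝ} (ht : t ≠ 0) : cbrt t ≠ 0 := fun h => ht <| by
  rw [← cbrt_pow_three t, h]
  norm_num

lemma hasDerivAt_cbrt_of_pos {t : ℝ} (ht : 0 < t) :
    HasDerivAt cbrt (1 / (3 * cbrt t ^ 2)) t := by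
  have h := Real.hasDerivAt_rpow_const (x := t) (p := (1 : ℝ) / 3) (Or.inl ht.ne')
  have hd : (1 : ℝ) / 3 * t ^ ((1 : ℝ) / 3 - 1) = 1 / (3 * cbrt t ^ 2) := by
    have hc := cbrt_ne_zero ht.ne'
    rw [Real.rpow_sub ht, Real.rpow_one, ← cbrt_of_pos ht]
    have h3 := cbrt_pow_three t
    field_simp
    linear_combination h3
  rw [hd] at h
  exact h.congr_of_eventuallyEq ((eventually_gt_nhds ht).mono fun s hs => cbrt_of_pos hs)

lemma hasDerivAt_cbrt {t : ℝ} (ht : t ≠ 0) :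
    HasDerivAt cbrt (1 / (3 * cbrt t ^ 2)) t := by
  rcases lt_or_gt_of_ne ht with h | h
  · have h1 := ((hasDerivAt_cbrt_of_pos (neg_pos.2 h)).comp t (hasDerivAt_neg t)).neg
    have hf : -cbrt ∘ Neg.neg = cbrt := by
      funext s
      simp [cbrt_neg]
    rw [hf] at h1
    refine h1.congr_deriv ?_
    rw [cbrt_neg]
    ring
  · exact hasDerivAt_cbrt_of_pos h

lemma hasDerivAt_two_mul_add (k t : ℝ) : HasDerivAt (fun s : ℝ => 2 * s + k) 2 t := by
  simpa using ((hasDerivAt_id t).const_mul 2).add_const k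

lemma hasDerivAt_cbrt_quadratic (ζ k m t : ℝ) (h : ζ * ((2 * t + k) ^ 2 + m) ≠ 0) :
    HasDerivAt (fun s => cbrt (ζ * ((2 * s + k) ^ 2 + m)))
      (4 * ζ * (2 * t + k) / (3 * cbrt (ζ * ((2 * t + k) ^ 2 + m)) ^ 2)) t := by
  have h1 := (((hasDerivAt_two_mul_add k t).pow 2).add_const m).const_mul ζ
  refine ((hasDerivAt_cbrt h).comp t h1).congr_deriv ?_
  push_cast
  ring

/-- An explicit exact solution of the semi-Hamiltonian system (4.1)
(the case `α = β = 0` of the hodograph solutions), together with the associated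
magnetic field `Ω = (g_x − f_y)/4`. -/
theorem statement5 (γ δ ε ζ : ℝ) (hζ : ζ ≠ 0)
    (Λ u₀ f g : ℝ × ℝ → ℝ)
    (hΛdef : Λ = fun p =>
      -(1 / (2 * ζ)) * cbrt (ζ * ((2 * p.1 + δ) ^ 2 + (2 * p.2 + γ) ^ 2)))
    (hu₀def : u₀ = fun _ => 4 * ε / ζ)
    (hfdef : f = fun p =>
      (2 * p.2 + γ) / cbrt (ζ * ((2 * p.2 + γ) ^ 2 + (2 * p.1 + δ) ^ 2)))
    (hgdef : g = fun p =>
      -(2 * p.1 + δ) / cbrt (ζ * ((2 * p.2 + γ) ^ 2 + (2 * p.1 + δ) ^ 2))) :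
    ∀ p : ℝ × ℝ, (2 * p.1 + δ) ^ 2 + (2 * p.2 + γ) ^ 2 ≠ 0 →
      (pdx f p + pdy g p = 0 ∧
       f p * pdx Λ p + Λ p * pdx f p - g p * pdy Λ p - Λ p * pdy g p = 0 ∧
       2 * pdx Λ p + pdx u₀ p + (g p / 2) * pdx g p - (g p / 2) * pdy f p = 0 ∧
       -(f p / 2) * pdx g p + 2 * pdy Λ p - pdy u₀ p + (f p / 2) * pdy f p = 0) ∧
      (pdx g p - pdy f p) / 4 =
        -2 / (3 * cbrt (ζ * ((2 * p.1 + δ) ^ 2 + (2 * p.2 + γ) ^ 2))) := by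
  rintro ⟨x, y⟩ hp
  simp only [add_comm ((2 * _ + γ) ^ 2) ((2 * _ + δ) ^ 2)] at hfdef hgdef
  subst hΛdef hu₀def hfdef hgdef
  simp only [pdx, pdy] at hp ⊢
  have hr : ζ * ((2 * x + δ) ^ 2 + (2 * y + γ) ^ 2) ≠ 0 := mul_ne_zero hζ hp
  have hcx := hasDerivAt_cbrt_quadratic ζ δ ((2 * y + γ) ^ 2) x hr
  have hcy := hasDerivAt_cbrt_quadratic ζ γ ((2 * x + δ) ^ 2) y (by rwa [add_comm])
  simp only [add_comm _ ((2 * x + δ) ^ 2)] at hcy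
  have hc := cbrt_ne_zero hr
  have h3 := cbrt_pow_three (ζ * ((2 * x + δ) ^ 2 + (2 * y + γ) ^ 2))
  have ha := hasDerivAt_two_mul_add δ x
  have hb := hasDerivAt_two_mul_add γ y
  have hfx := ((hasDerivAt_const x (2 * y + γ)).fun_div hcx hc).deriv
  have hfy := (hb.fun_div hcy hc).deriv
  have hgx := (ha.fun_neg.fun_div hcx hc).deriv
  have hgy := ((hasDerivAt_const y (-(2 * x + δ))).fun_div hcy hc).deriv
  have hΛx := (hcx.const_mul (-(1 / (2 * ζ)))).deriv
  have hΛy := (hcy.const_mul (-(1 / (2 * ζ)))).deriv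
  rw [hfx, hfy, hgx, hgy, hΛx, hΛy, deriv_const, deriv_const]
  clear hfx hfy hgx hgy hΛx hΛy hcx hcy ha hb hr hp
  generalize cbrt (ζ * ((2 * x + δ) ^ 2 + (2 * y + γ) ^ 2)) = c at *
  generalize 2 * x + δ = a at *
  generalize 2 * y + γ = b at *
  have hΩ : (-2 * c - -a * (4 * ζ * a / (3 * c ^ 2))) / c ^ 2 -
      (2 * c - b * (4 * ζ * b / (3 * c ^ 2))) / c ^ 2 = -8 / (3 * c) := by
    field_simp
    linear_combination (-4) * h3
  refine ⟨⟨?_, ?_, ?_, ?_⟩, ?_⟩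
  · field_simp
    ring
  · field_simp
    ring
  · have e : -(1 / (2 * ζ)) * (4 * ζ * a / (3 * c ^ 2)) = -(2 * a) / (3 * c ^ 2) := by
      field_simp
      ring
    rw [e]
    have e2 : -a / c / 2 * (-8 / (3 * c)) = 4 * a / (3 * c ^ 2) := by
      field_simp
      ring
    linear_combination (-a / c / 2) * hΩ + e2
  · have e : -(1 / (2 * ζ)) * (4 * ζ * b / (3 * c ^ 2)) = -(2 * b) / (3 * c ^ 2) := by
      field_simp
      ring
    rw [e]
    have e2 : -(b / c / 2) * (-8 / (3 * c)) = 4 * b / (3 * c ^ 2) := by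
      field_simp
      ring
    linear_combination -(b / c / 2) * hΩ + e2
  · rw [hΩ]
    field_simp
    norm_num
end

section
/- Let γ ≠ 0 and C > 0 be real constants. Let ρ, ψ be C¹ functions on an open set U ⊂ ℝ² with ρ > −1, satisfying the system (5.8): (ρ sin ψ)_x + (ρ cos ψ)_y = 0 and ((ρ+1) sin ψ)_y − ((ρ+1) cos ψ)_x = 0 on U. Define Λ = γ²(ρ+1)/C, Ω = −(γ/2)(ψ_x sin ψ + ψ_y cos ψ), H(x,y,p₁,p₂) = (p₁² + p₂²)/(2Λ(x,y)), and F(x,y,p₁,p₂) = (cos(ψ/2)·p₁ − sin(ψ/2)·p₂ + γ sin(ψ/2)) / (sin(ψ/2)·p₁ + cos(ψ/2)·p₂ + γ cos(ψ/2)). Then the magnetic Poisson bracket {F,H}_mg vanishes at every point (x,y,p₁,p₂) with (x,y) ∈ U, H(x,y,p₁,p₂) = C/2, and nonvanishing denominator of F. -/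
open Real

/-- Derivative of the fractional-linear function of the momenta along a curve of angles. -/
theorem hasDerivAt_momentum_quotient_angle {θ : ℝ → ℝ} {θ' t : ℝ} (γ p₁ p₂ : ℝ)
    (hθ : HasDerivAt θ θ' t)
    (hD : sin (θ t / 2) * p₁ + cos (θ t / 2) * p₂ + γ * cos (θ t / 2) ≠ 0) :
    HasDerivAt (fun t => (cos (θ t / 2) * p₁ - sin (θ t / 2) * p₂ + γ * sin (θ t / 2)) /
        (sin (θ t / 2) * p₁ + cos (θ t / 2) * p₂ + γ * cos (θ t / 2)))
      (θ' / 2 * (γ ^ 2 - (p₁ ^ 2 + p₂ ^ 2)) /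
        (sin (θ t / 2) * p₁ + cos (θ t / 2) * p₂ + γ * cos (θ t / 2)) ^ 2) t := by
  have hs := (hθ.div_const 2).sin
  have hc := (hθ.div_const 2).cos
  refine ((((hc.mul_const p₁).sub (hs.mul_const p₂)).add (hs.const_mul γ)).div
    (((hs.mul_const p₁).add (hc.mul_const p₂)).add (hc.const_mul γ)) hD).congr_deriv ?_
  simp only [Pi.add_apply, Pi.sub_apply]
  congr 1
  linear_combination (θ' / 2 * (γ ^ 2 - (p₁ ^ 2 + p₂ ^ 2))) * sin_sq_add_cos_sq (θ t / 2)

/-- Derivative of the kinetic energy along a curve of conformal factors. -/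
theorem hasDerivAt_energy_factor {r : ℝ → ℝ} {r' t : ℝ} (γ C e : ℝ) (hγ : γ ≠ 0) (hC : C ≠ 0)
    (hr : HasDerivAt r r' t) (hpos : r t + 1 ≠ 0) :
    HasDerivAt (fun t => e / (2 * (γ ^ 2 * (r t + 1) / C)))
      (-(e * C * r') / (2 * γ ^ 2 * (r t + 1) ^ 2)) t := by
  have h := (hasDerivAt_const t e).div
    ((((hr.add_const 1).const_mul (γ ^ 2)).div_const C).const_mul 2) (by positivity)
  refine h.congr_deriv ?_
  field_simp
  ring

/-- A solution `(ρ, ψ)` of the system (5.8) produces a metric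
`Λ = γ²(ρ+1)/C`, a magnetic field `Ω = −(γ/2)(ψ_x sin ψ + ψ_y cos ψ)` and a rational
first integral `F` at the energy level `{H = C/2}`. -/
theorem statement8 (γ C : ℝ) (hγ : γ ≠ 0) (hC : 0 < C)
    (U : Set (ℝ × ℝ)) (hU : IsOpen U)
    (ρ ψ : ℝ × ℝ → ℝ)
    (hρ : ContDiffOn ℝ 1 ρ U) (hψ : ContDiffOn ℝ 1 ψ U)
    (hρpos : ∀ p ∈ U, -1 < ρ p)
    (h58a : ∀ p ∈ U,
      pdx (fun q => ρ q * Real.sin (ψ q)) p + pdy (fun q => ρ q * Real.cos (ψ q)) p = 0)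
    (h58b : ∀ p ∈ U,
      pdy (fun q => (ρ q + 1) * Real.sin (ψ q)) p
        - pdx (fun q => (ρ q + 1) * Real.cos (ψ q)) p = 0)
    (Λ : ℝ × ℝ → ℝ) (hΛdef : Λ = fun p => γ ^ 2 * (ρ p + 1) / C)
    (Ω : ℝ × ℝ → ℝ)
    (hΩdef : Ω = fun p =>
      -(γ / 2) * (pdx ψ p * Real.sin (ψ p) + pdy ψ p * Real.cos (ψ p)))
    (H F : ℝ → ℝ → ℝ → ℝ → ℝ)
    (hHdef : H = fun x y p₁ p₂ => (p₁ ^ 2 + p₂ ^ 2) / (2 * Λ (x, y)))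
    (hFdef : F = fun x y p₁ p₂ =>
      (Real.cos (ψ (x, y) / 2) * p₁ - Real.sin (ψ (x, y) / 2) * p₂
          + γ * Real.sin (ψ (x, y) / 2)) /
        (Real.sin (ψ (x, y) / 2) * p₁ + Real.cos (ψ (x, y) / 2) * p₂
          + γ * Real.cos (ψ (x, y) / 2))) :
    ∀ x y p₁ p₂ : ℝ, (x, y) ∈ U → H x y p₁ p₂ = C / 2 →
      Real.sin (ψ (x, y) / 2) * p₁ + Real.cos (ψ (x, y) / 2) * p₂
        + γ * Real.cos (ψ (x, y) / 2) ≠ 0 →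
      magneticBracket (fun x y => Ω (x, y)) F H x y p₁ p₂ = 0 := by
  intro x y p₁ p₂ hxy hH hD
  subst hΛdef hΩdef hHdef hFdef
  have hUn : U ∈ nhds (x, y) := hU.mem_nhds hxy
  have slice_x : ∀ f : ℝ × ℝ → ℝ, ContDiffOn ℝ 1 f U →
      HasDerivAt (fun t => f (t, y)) (pdx f (x, y)) x := fun f hf => by
    have h : DifferentiableAt ℝ f (x, y) := (hf.contDiffAt hUn).differentiableAt (by norm_num)
    exact (DifferentiableAt.comp x (f := fun t : ℝ => (t, y)) h (by fun_prop)).hasDerivAt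
  have slice_y : ∀ f : ℝ × ℝ → ℝ, ContDiffOn ℝ 1 f U →
      HasDerivAt (fun t => f (x, t)) (pdy f (x, y)) y := fun f hf => by
    have h : DifferentiableAt ℝ f (x, y) := (hf.contDiffAt hUn).differentiableAt (by norm_num)
    exact (DifferentiableAt.comp y (f := fun t : ℝ => (x, t)) h (by fun_prop)).hasDerivAt
  have hρx := slice_x ρ hρ
  have hρy := slice_y ρ hρ
  have hψx := slice_x ψ hψ
  have hψy := slice_y ψ hψ
  have ha := h58a (x, y) hxy
  have hb := h58b (x, y) hxy
  have ea1 : pdx (fun q => ρ q * sin (ψ q)) (x, y) = _ := (hρx.mul hψx.sin).deriv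
  have ea2 : pdy (fun q => ρ q * cos (ψ q)) (x, y) = _ := (hρy.mul hψy.cos).deriv
  have eb1 : pdy (fun q => (ρ q + 1) * sin (ψ q)) (x, y) = _ :=
    ((hρy.add_const 1).mul hψy.sin).deriv
  have eb2 : pdx (fun q => (ρ q + 1) * cos (ψ q)) (x, y) = _ :=
    ((hρx.add_const 1).mul hψx.cos).deriv
  rw [ea1, ea2] at ha
  rw [eb1, eb2] at hb
  have hR : ρ (x, y) + 1 ≠ 0 := by linarith [hρpos (x, y) hxy]
  have hC' : C ≠ 0 := hC.ne'
  have energy : p₁ ^ 2 + p₂ ^ 2 = γ ^ 2 * (ρ (x, y) + 1) := by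
    simp only at hH
    field_simp at hH
    linarith
  have Fx := (hasDerivAt_momentum_quotient_angle γ p₁ p₂ hψx hD).deriv
  have Fy := (hasDerivAt_momentum_quotient_angle γ p₁ p₂ hψy hD).deriv
  have Hx := (hasDerivAt_energy_factor γ C (p₁ ^ 2 + p₂ ^ 2) hγ hC' hρx hR).deriv
  have Hy := (hasDerivAt_energy_factor γ C (p₁ ^ 2 + p₂ ^ 2) hγ hC' hρy hR).deriv
  have H₁ : deriv (fun t => (t ^ 2 + p₂ ^ 2) / (2 * (γ ^ 2 * (ρ (x, y) + 1) / C))) p₁ =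
      p₁ * C / (γ ^ 2 * (ρ (x, y) + 1)) := by
    rw [(((hasDerivAt_pow 2 p₁).add_const (p₂ ^ 2)).div_const _).deriv]
    field_simp
    norm_num
  have H₂ : deriv (fun t => (p₁ ^ 2 + t ^ 2) / (2 * (γ ^ 2 * (ρ (x, y) + 1) / C))) p₂ =
      p₂ * C / (γ ^ 2 * (ρ (x, y) + 1)) := by
    rw [(((hasDerivAt_pow 2 p₂).const_add (p₁ ^ 2)).div_const _).deriv]
    field_simp
    norm_num
  have hsin : sin (ψ (x, y)) = 2 * sin (ψ (x, y) / 2) * cos (ψ (x, y) / 2) := by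
    rw [← sin_two_mul]
    ring_nf
  have hcos : cos (ψ (x, y)) = cos (ψ (x, y) / 2) ^ 2 - sin (ψ (x, y) / 2) ^ 2 := by
    rw [← cos_two_mul']
    ring_nf
  have hsc := sin_sq_add_cos_sq (ψ (x, y) / 2)
  have hSC := sin_sq_add_cos_sq (ψ (x, y))
  set s := sin (ψ (x, y) / 2)
  set c := cos (ψ (x, y) / 2)
  set D := s * p₁ + c * p₂ + γ * c with hDdef
  have F₁ : deriv (fun t => (c * t - s * p₂ + γ * s) / (s * t + c * p₂ + γ * c)) p₁ =
      (p₂ + γ * cos (ψ (x, y))) / D ^ 2 := by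
    refine (((((hasDerivAt_id p₁).const_mul c).sub_const (s * p₂)).add_const (γ * s)).div
      ((((hasDerivAt_id p₁).const_mul s).add_const (c * p₂)).add_const (γ * c)) hD).deriv.trans ?_
    simp only [id]
    rw [← hDdef, hcos]
    congr 1
    rw [hDdef]
    linear_combination p₂ * hsc
  have F₂ : deriv (fun t => (c * p₁ - s * t + γ * s) / (s * p₁ + c * t + γ * c)) p₂ =
      -(p₁ + γ * sin (ψ (x, y))) / D ^ 2 := by
    refine (((((hasDerivAt_id p₂).const_mul s).const_sub (c * p₁)).add_const (γ * s)).div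
      ((((hasDerivAt_id p₂).const_mul c).const_add (s * p₁)).add_const (γ * c)) hD).deriv.trans ?_
    simp only [id]
    rw [← hDdef, hsin]
    congr 1
    rw [hDdef]
    linear_combination (-p₁) * hsc
  have hRx : pdx ρ (x, y) = pdx ψ (x, y) * sin (ψ (x, y)) * cos (ψ (x, y))
      + pdy ψ (x, y) * (ρ (x, y) + cos (ψ (x, y)) ^ 2) := by
    linear_combination sin (ψ (x, y)) * ha - cos (ψ (x, y)) * hb
      + (ρ (x, y) * pdy ψ (x, y) - pdx ρ (x, y)) * hSC
  have hRy : pdy ρ (x, y) = -pdx ψ (x, y) * (ρ (x, y) + sin (ψ (x, y)) ^ 2)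
      - pdy ψ (x, y) * sin (ψ (x, y)) * cos (ψ (x, y)) := by
    linear_combination cos (ψ (x, y)) * ha + sin (ψ (x, y)) * hb
      - (ρ (x, y) * pdx ψ (x, y) + pdy ρ (x, y)) * hSC
  simp only [magneticBracket]
  rw [Fx, Fy, Hx, Hy, H₁, H₂, F₁, F₂, energy, hRx, hRy]
  generalize cos (ψ (x, y)) = k at *
  generalize sin (ψ (x, y)) = m at *
  generalize pdx ψ (x, y) = u at *
  generalize pdy ψ (x, y) = v at *
  generalize ρ (x, y) = r at *
  field_simp
  linear_combination (-C * (u * m + k * v)) * energy + C * γ ^ 2 * (u * m + k * v) * hSC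
end

section
/- (Theorem 2) Let Z = Z(ρ,ψ) be a C³ solution of the equation (5.11): ρ(ρ+1)Z_ρρ + ρZ_ρ + Z_ψψ = 0 on an open subset of the (ρ,ψ)-plane. Suppose ρ(x,y) and ψ(x,y) are differentiable functions on an open set U ⊂ ℝ² with ρ ≠ 0, satisfying the relations (5.13): Z_ρ(ρ(x,y), ψ(x,y)) = −x cos ψ(x,y) + y sin ψ(x,y) and Z_ψ(ρ(x,y), ψ(x,y)) = x ρ(x,y) sin ψ(x,y) + y ρ(x,y) cos ψ(x,y), and assume that along (ρ(x,y), ψ(x,y)) the quantity D = ρ(ρ+1)Z_ρρ² + (Z_ψρ − Z_ψ/ρ)² is nonzero. Then ρ(x,y) and ψ(x,y) are solutions of the system (5.8) on U: (ρ sin ψ)_x + (ρ cos ψ)_y = 0 and ((ρ+1) sin ψ)_y − ((ρ+1) cos ψ)_x = 0. -/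
open Real

theorem HasFDerivAt.pdx_eq {f : ℝ × ℝ → ℝ} {f' : ℝ × ℝ →L[ℝ] ℝ} {p : ℝ × ℝ}
    (h : HasFDerivAt f f' p) : pdx f p = f' (1, 0) :=
  (HasFDerivAt.comp_hasDerivAt (f := fun t : ℝ => (t, p.2)) p.1 h
    ((hasDerivAt_id p.1).prodMk (hasDerivAt_const p.1 p.2))).deriv

theorem HasFDerivAt.pdy_eq {f : ℝ × ℝ → ℝ} {f' : ℝ × ℝ →L[ℝ] ℝ} {p : ℝ × ℝ}
    (h : HasFDerivAt f f' p) : pdy f p = f' (0, 1) :=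
  (HasFDerivAt.comp_hasDerivAt (f := fun t : ℝ => (p.1, t)) p.2 h
    ((hasDerivAt_const p.2 p.1).prodMk (hasDerivAt_id p.2))).deriv

theorem ContinuousLinearMap.apply_eq_pdx_add_pdy (L : ℝ × ℝ →L[ℝ] ℝ) (v : ℝ × ℝ) :
    L v = L (1, 0) * v.1 + L (0, 1) * v.2 := by
  have hv : v = v.1 • ((1, 0) : ℝ × ℝ) + v.2 • ((0, 1) : ℝ × ℝ) := by
    ext <;> simp
  conv_lhs => rw [hv]
  simp only [map_add, map_smul, smul_eq_mul]
  ring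

theorem ContDiffAt.differentiableAt_fderiv {Z : ℝ × ℝ → ℝ} {q : ℝ × ℝ}
    (hZ : ContDiffAt ℝ 2 Z q) : DifferentiableAt ℝ (fderiv ℝ Z) q :=
  (hZ.fderiv_right (m := 1) (by norm_num)).differentiableAt (by norm_num)

theorem ContDiffAt.hasFDerivAt_pdx {Z : ℝ × ℝ → ℝ} {q : ℝ × ℝ} (hZ : ContDiffAt ℝ 2 Z q) :
    HasFDerivAt (pdx Z) ((fderiv ℝ (fderiv ℝ Z) q).flip (1, 0)) q := by
  have h := hZ.differentiableAt_fderiv.hasFDerivAt.clm_apply (hasFDerivAt_const ((1, 0) : ℝ × ℝ) q)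
  refine (h.congr_of_eventuallyEq ?_).congr_fderiv (by ext <;> simp)
  filter_upwards [hZ.eventually (by simp)] with z hz
  exact (hz.differentiableAt (by norm_num)).hasFDerivAt.pdx_eq

theorem ContDiffAt.hasFDerivAt_pdy {Z : ℝ × ℝ → ℝ} {q : ℝ × ℝ} (hZ : ContDiffAt ℝ 2 Z q) :
    HasFDerivAt (pdy Z) ((fderiv ℝ (fderiv ℝ Z) q).flip (0, 1)) q := by
  have h := hZ.differentiableAt_fderiv.hasFDerivAt.clm_apply (hasFDerivAt_const ((0, 1) : ℝ × ℝ) q)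
  refine (h.congr_of_eventuallyEq ?_).congr_fderiv (by ext <;> simp)
  filter_upwards [hZ.eventually (by simp)] with z hz
  exact (hz.differentiableAt (by norm_num)).hasFDerivAt.pdy_eq

theorem ContDiffAt.pdx_pdy_eq_pdy_pdx {Z : ℝ × ℝ → ℝ} {q : ℝ × ℝ} (hZ : ContDiffAt ℝ 2 Z q) :
    pdx (pdy Z) q = pdy (pdx Z) q := by
  rw [hZ.hasFDerivAt_pdy.pdx_eq, hZ.hasFDerivAt_pdx.pdy_eq]
  exact (hZ.isSymmSndFDerivAt (by simp)) (1, 0) (0, 1)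

/-- Solving the differentiated hodograph relations in terms of the first derivatives. -/
theorem hodograph_algebra {r c s A E rx ry px py : ℝ}
    (hD : r * (r + 1) * A ^ 2 + E ^ 2 ≠ 0)
    (hax : A * rx + E * px = -c) (hay : A * ry + E * py = s)
    (hbx : E * rx - r * (r + 1) * A * px = r * s)
    (hby : E * ry - r * (r + 1) * A * py = r * c) :
    rx * s + r * (c * px) + (ry * c - r * (s * py)) = 0 ∧
      ry * s + (r + 1) * (c * py) - (rx * c - (r + 1) * (s * px)) = 0 := by
  have hrx : (r * (r + 1) * A ^ 2 + E ^ 2) * rx = -c * r * (r + 1) * A + E * r * s := by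
    linear_combination r * (r + 1) * A * hax + E * hbx
  have hpx : (r * (r + 1) * A ^ 2 + E ^ 2) * px = -c * E - A * r * s := by
    linear_combination E * hax - A * hbx
  have hry : (r * (r + 1) * A ^ 2 + E ^ 2) * ry = s * r * (r + 1) * A + E * r * c := by
    linear_combination r * (r + 1) * A * hay + E * hby
  have hpy : (r * (r + 1) * A ^ 2 + E ^ 2) * py = s * E - A * r * c := by
    linear_combination E * hay - A * hby
  constructor <;> refine (mul_eq_zero.mp ?_).resolve_left hD
  · linear_combination s * hrx + r * c * hpx + c * hry - r * s * hpy
  · linear_combination s * hry + (r + 1) * c * hpy - c * hrx + (r + 1) * s * hpx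

/-- Theorem 2 of the paper. If `Z(ρ,ψ)` is a `C³` solution of the linear
equation (5.11) and `ρ(x,y)`, `ψ(x,y)` are differentiable functions satisfying the
relations (5.13) with the nondegeneracy condition `D ≠ 0`, then `ρ(x,y)`, `ψ(x,y)` solve
the system (5.8). -/
theorem statement11 (V : Set (ℝ × ℝ)) (hV : IsOpen V)
    (Z : ℝ × ℝ → ℝ) (hZ : ContDiffOn ℝ 3 Z V)
    (h511 : ∀ q ∈ V,
      q.1 * (q.1 + 1) * pdx (pdx Z) q + q.1 * pdx Z q + pdy (pdy Z) q = 0)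
    (U : Set (ℝ × ℝ)) (hU : IsOpen U)
    (ρ ψ : ℝ × ℝ → ℝ)
    (hρ : DifferentiableOn ℝ ρ U) (hψ : DifferentiableOn ℝ ψ U)
    (hρ0 : ∀ p ∈ U, ρ p ≠ 0)
    (hmem : ∀ p ∈ U, (ρ p, ψ p) ∈ V)
    (h513a : ∀ p ∈ U,
      pdx Z (ρ p, ψ p) = -p.1 * Real.cos (ψ p) + p.2 * Real.sin (ψ p))
    (h513b : ∀ p ∈ U,
      pdy Z (ρ p, ψ p) = p.1 * ρ p * Real.sin (ψ p) + p.2 * ρ p * Real.cos (ψ p))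
    (hD : ∀ p ∈ U,
      ρ p * (ρ p + 1) * (pdx (pdx Z) (ρ p, ψ p)) ^ 2
        + (pdy (pdx Z) (ρ p, ψ p) - pdy Z (ρ p, ψ p) / ρ p) ^ 2 ≠ 0) :
    ∀ p ∈ U,
      pdx (fun q => ρ q * Real.sin (ψ q)) p + pdy (fun q => ρ q * Real.cos (ψ q)) p = 0 ∧
      pdy (fun q => (ρ q + 1) * Real.sin (ψ q)) p
        - pdx (fun q => (ρ q + 1) * Real.cos (ψ q)) p = 0 := by
  intro p hp
  have hUp : U ∈ nhds p := hU.mem_nhds hp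
  have hZq : ContDiffAt ℝ 2 Z (ρ p, ψ p) :=
    (hZ.contDiffAt (hV.mem_nhds (hmem p hp))).of_le (by norm_num)
  have hρ' := (hρ.differentiableAt hUp).hasFDerivAt
  have hψ' := (hψ.differentiableAt hUp).hasFDerivAt
  have hfst : HasFDerivAt (fun z : ℝ × ℝ => z.1) (ContinuousLinearMap.fst ℝ ℝ ℝ) p :=
    hasFDerivAt_fst
  have hsnd : HasFDerivAt (fun z : ℝ × ℝ => z.2) (ContinuousLinearMap.snd ℝ ℝ ℝ) p :=
    hasFDerivAt_snd
  have hca := hZq.hasFDerivAt_pdx.comp p (hρ'.prodMk hψ')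
  have ha := hca.unique
    (((hfst.neg.mul hψ'.cos).add (hsnd.mul hψ'.sin)).congr_of_eventuallyEq
      (Filter.eventuallyEq_of_mem hUp fun z hz => h513a z hz))
  have hcb := hZq.hasFDerivAt_pdy.comp p (hρ'.prodMk hψ')
  have hb := hcb.unique
    ((((hfst.mul hρ').mul hψ'.sin).add ((hsnd.mul hρ').mul hψ'.cos)).congr_of_eventuallyEq
      (Filter.eventuallyEq_of_mem hUp fun z hz => h513b z hz))
  have hax := DFunLike.congr_fun ha (1, 0)
  have hay := DFunLike.congr_fun ha (0, 1)
  have hbx := DFunLike.congr_fun hb (1, 0)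
  have hby := DFunLike.congr_fun hb (0, 1)
  rw [ContinuousLinearMap.comp_apply, ContinuousLinearMap.apply_eq_pdx_add_pdy,
    ← hZq.hasFDerivAt_pdx.pdx_eq, ← hZq.hasFDerivAt_pdx.pdy_eq] at hax hay
  rw [ContinuousLinearMap.comp_apply, ContinuousLinearMap.apply_eq_pdx_add_pdy,
    ← hZq.hasFDerivAt_pdy.pdx_eq, ← hZq.hasFDerivAt_pdy.pdy_eq,
    hZq.pdx_pdy_eq_pdy_pdx] at hbx hby
  have h1 := (hρ'.mul hψ'.sin).pdx_eq
  have h2 := (hρ'.mul hψ'.cos).pdy_eq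
  have h3 := ((hρ'.add_const 1).mul hψ'.sin).pdy_eq
  have h4 := ((hρ'.add_const 1).mul hψ'.cos).pdx_eq
  simp at hax hay hbx hby h1 h2 h3 h4
  have hpde := h511 _ (hmem p hp)
  have hP := h513a p hp
  have hr := hρ0 p hp
  have hQ : pdy Z (ρ p, ψ p) / ρ p = p.1 * sin (ψ p) + p.2 * cos (ψ p) := by
    rw [h513b p hp]
    field_simp
  have hDp := hD p hp
  rw [hQ] at hDp
  dsimp only at hpde
  rw [hP] at hpde
  obtain ⟨e1, e2⟩ := hodograph_algebra (c := cos (ψ p)) (s := sin (ψ p))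
    (rx := fderiv ℝ ρ p (1, 0)) (ry := fderiv ℝ ρ p (0, 1))
    (px := fderiv ℝ ψ p (1, 0)) (py := fderiv ℝ ψ p (0, 1)) hDp
    (by linear_combination hax) (by linear_combination hay)
    (by linear_combination hbx - fderiv ℝ ψ p (1, 0) * hpde)
    (by linear_combination hby - fderiv ℝ ψ p (0, 1) * hpde)
  constructor
  · refine (congrArg₂ (· + ·) h1 h2).trans ?_
    linear_combination e1
  · refine (congrArg₂ (· - ·) h3 h4).trans ?_
    linear_combination e2
end

section
/- The function Z(ρ,ψ) = ((2/3)ρ + ρ²)·cos(2ψ) is a solution of equation (5.11): ρ(ρ+1)Z_ρρ + ρZ_ρ + Z_ψψ = 0 on all of ℝ². -/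
open Real

theorem pdx_mul_snd {g g' h : ℝ → ℝ} (hg : ∀ x, HasDerivAt g (g' x) x) :
    pdx (fun p => g p.1 * h p.2) = fun p => g' p.1 * h p.2 :=
  funext fun p => ((hg p.1).mul_const (h p.2)).deriv

theorem pdy_fst_mul {g h h' : ℝ → ℝ} (hh : ∀ y, HasDerivAt h (h' y) y) :
    pdy (fun p => g p.1 * h p.2) = fun p => g p.1 * h' p.2 :=
  funext fun p => ((hh p.2).const_mul (g p.1)).deriv

/-- `Z(ρ,ψ) = ((2/3)ρ + ρ²)cos(2ψ)` solves equation (5.11):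
`ρ(ρ+1)Z_ρρ + ρZ_ρ + Z_ψψ = 0` on all of `ℝ²`. -/
theorem statement16 :
    ∀ q : ℝ × ℝ,
      q.1 * (q.1 + 1) *
          pdx (pdx (fun p => ((2 / 3) * p.1 + p.1 ^ 2) * Real.cos (2 * p.2))) q
        + q.1 * pdx (fun p => ((2 / 3) * p.1 + p.1 ^ 2) * Real.cos (2 * p.2)) q
        + pdy (pdy (fun p => ((2 / 3) * p.1 + p.1 ^ 2) * Real.cos (2 * p.2))) q = 0 := by
  have hg (x : ℝ) : HasDerivAt (fun x : ℝ => (2 / 3) * x + x ^ 2) (2 / 3 + 2 * x) x := by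
    simpa using ((hasDerivAt_id x).const_mul (2 / 3 : ℝ)).fun_add (hasDerivAt_pow 2 x)
  have hg' (x : ℝ) : HasDerivAt (fun x : ℝ => 2 / 3 + 2 * x) 2 x := by
    simpa using ((hasDerivAt_id x).const_mul (2 : ℝ)).const_add (2 / 3)
  have hl (y : ℝ) : HasDerivAt (fun y : ℝ => 2 * y) 2 y := by
    simpa using (hasDerivAt_id y).const_mul (2 : ℝ)
  have hh (y : ℝ) : HasDerivAt (fun y : ℝ => Real.cos (2 * y)) (-Real.sin (2 * y) * 2) y :=
    (hl y).cos
  have hh' (y : ℝ) : HasDerivAt (fun y : ℝ => -Real.sin (2 * y) * 2)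
      (-(Real.cos (2 * y) * 2) * 2) y :=
    (hl y).sin.neg.mul_const 2
  intro q
  rw [pdx_mul_snd (h := fun y => Real.cos (2 * y)) hg,
    pdx_mul_snd (h := fun y => Real.cos (2 * y)) hg',
    pdy_fst_mul (g := fun x => (2 / 3) * x + x ^ 2) hh,
    pdy_fst_mul (g := fun x => (2 / 3) * x + x ^ 2) hh']
  ring
end

section
/- The function Z(ρ,ψ) = (ρ·ln(1 + 1/ρ) − 1)·cos ψ is a solution of equation (5.11): ρ(ρ+1)Z_ρρ + ρZ_ρ + Z_ψψ = 0 on the domain {ρ > 0}. -/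
open Real

theorem hasDerivAt_log_one_add_one_div {x : ℝ} (hx : 0 < x) :
    HasDerivAt (fun t : ℝ => Real.log (1 + 1 / t)) (-1 / (x * (x + 1))) x := by
  have hpos : 1 + x⁻¹ ≠ 0 := by positivity
  have h := ((hasDerivAt_inv hx.ne').const_add 1).log hpos
  simp only [one_div]
  refine h.congr_deriv ?_
  field_simp

theorem hasDerivAt_mul_log_one_add_one_div_sub_one {x : ℝ} (hx : 0 < x) :
    HasDerivAt (fun t : ℝ => t * Real.log (1 + 1 / t) - 1)
      (Real.log (1 + 1 / x) - 1 / (x + 1)) x := by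
  refine (((hasDerivAt_id' x).mul (hasDerivAt_log_one_add_one_div hx)).sub_const 1).congr_deriv ?_
  field_simp
  ring

theorem hasDerivAt_log_one_add_one_div_sub {x : ℝ} (hx : 0 < x) :
    HasDerivAt (fun t : ℝ => Real.log (1 + 1 / t) - 1 / (t + 1))
      (-1 / (x * (x + 1) ^ 2)) x := by
  have hne : x + 1 ≠ 0 := by positivity
  have h := (hasDerivAt_log_one_add_one_div hx).sub (((hasDerivAt_id' x).add_const 1).inv hne)
  simp only [one_div] at h ⊢
  refine h.congr_deriv ?_
  field_simp
  ring

theorem pdx_mul_cos {f : ℝ → ℝ} {f' : ℝ} {p : ℝ × ℝ} (hf : HasDerivAt f f' p.1) :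
    pdx (fun p => f p.1 * Real.cos p.2) p = f' * Real.cos p.2 :=
  (hf.mul_const (Real.cos p.2)).deriv

theorem pdy_pdy_mul_cos (f : ℝ → ℝ) (p : ℝ × ℝ) :
    pdy (pdy (fun p => f p.1 * Real.cos p.2)) p = -(f p.1 * Real.cos p.2) := by
  have h : pdy (fun p => f p.1 * Real.cos p.2) = fun p => f p.1 * -Real.sin p.2 :=
    funext fun p => ((Real.hasDerivAt_cos p.2).const_mul (f p.1)).deriv
  rw [h]
  exact ((Real.hasDerivAt_sin p.2).neg.const_mul (f p.1)).deriv.trans (mul_neg _ _)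

/-- `Z(ρ,ψ) = (ρ ln(1 + 1/ρ) − 1)cos ψ` solves equation (5.11):
`ρ(ρ+1)Z_ρρ + ρZ_ρ + Z_ψψ = 0` on the domain `{ρ > 0}`. -/
theorem statement17 :
    ∀ q : ℝ × ℝ, 0 < q.1 →
      q.1 * (q.1 + 1) *
          pdx (pdx (fun p => (p.1 * Real.log (1 + 1 / p.1) - 1) * Real.cos p.2)) q
        + q.1 * pdx (fun p => (p.1 * Real.log (1 + 1 / p.1) - 1) * Real.cos p.2) q
        + pdy (pdy (fun p => (p.1 * Real.log (1 + 1 / p.1) - 1) * Real.cos p.2)) q = 0 := by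
  intro q hq
  have hx : ∀ p : ℝ × ℝ, 0 < p.1 →
      pdx (fun p => (p.1 * Real.log (1 + 1 / p.1) - 1) * Real.cos p.2) p
        = (Real.log (1 + 1 / p.1) - 1 / (p.1 + 1)) * Real.cos p.2 := fun p hp =>
    pdx_mul_cos (hasDerivAt_mul_log_one_add_one_div_sub_one hp)
  have hxx : pdx (pdx (fun p => (p.1 * Real.log (1 + 1 / p.1) - 1) * Real.cos p.2)) q
      = -1 / (q.1 * (q.1 + 1) ^ 2) * Real.cos q.2 := by
    refine Eq.trans (Filter.EventuallyEq.deriv_eq ?_)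
      (pdx_mul_cos (hasDerivAt_log_one_add_one_div_sub hq))
    filter_upwards [lt_mem_nhds hq] with t ht
    exact hx (t, q.2) ht
  rw [hxx, hx q hq, pdy_pdy_mul_cos (fun t => t * Real.log (1 + 1 / t) - 1) q]
  generalize Real.log (1 + 1 / q.1) = L
  have hne : q.1 + 1 ≠ 0 := by positivity
  field_simp
  ring
end

section
/- Let k ≥ 1 be an integer and ψ₀ ∈ ℝ. Define the polynomial P_k(ρ) = −∑_{j=1}^{k} ((k+j−1)! / (k·(k−j)!·(j−1)!·j!))·ρʲ. Then P_k satisfies the ODE ρ(ρ+1)P_k''(ρ) + ρP_k'(ρ) − k²P_k(ρ) = 0 on ℝ, and consequently the function Z(ρ,ψ) = P_k(ρ)·cos(k(ψ + ψ₀)) is a solution of equation (5.11): ρ(ρ+1)Z_ρρ + ρZ_ρ + Z_ψψ = 0 on all of ℝ². -/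
open Real

/-- The polynomial `P_k(ρ) = −∑_{j=1}^{k} ((k+j−1)!/(k(k−j)!(j−1)!j!)) ρʲ`. -/
noncomputable def Pk (k : ℕ) (ρ : ℝ) : ℝ :=
  -∑ j ∈ Finset.Icc 1 k,
      ((Nat.factorial (k + j - 1) : ℝ) /
        (k * Nat.factorial (k - j) * Nat.factorial (j - 1) * Nat.factorial j)) * ρ ^ j

/-- The coefficient of `ρ ^ (i + 1)` in `-P_k`. -/
noncomputable def PkCoeff (k i : ℕ) : ℝ :=
  (Nat.factorial (k + i) : ℝ) /
    (k * Nat.factorial (k - (i + 1)) * Nat.factorial i * Nat.factorial (i + 1))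

theorem Pk_eq_sum_range (k : ℕ) (ρ : ℝ) :
    Pk k ρ = -∑ i ∈ Finset.range k, PkCoeff k i * ρ ^ (i + 1) := by
  rw [Pk, ← Finset.Ico_add_one_right_eq_Icc, Finset.sum_Ico_eq_sum_range, Nat.add_sub_cancel]
  refine congrArg _ (Finset.sum_congr rfl fun i _ => ?_)
  rw [add_comm 1 i, PkCoeff, ← add_assoc, Nat.add_sub_cancel, Nat.add_sub_cancel]

theorem PkCoeff_succ {k i : ℕ} (hi : i + 1 < k) :
    PkCoeff k (i + 1) * ((i + 1) * (i + 2)) = ((k : ℝ) ^ 2 - (i + 1) ^ 2) * PkCoeff k i := by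
  obtain ⟨m, rfl⟩ : ∃ m, k = i + 1 + 1 + m := ⟨k - (i + 2), by omega⟩
  have h₁ : i + 1 + 1 + m - (i + 1 + 1) = m := by omega
  have h₂ : i + 1 + 1 + m - (i + 1) = m + 1 := by omega
  simp only [PkCoeff, h₁, h₂, ← add_assoc (i + 1 + 1 + m) i 1, Nat.factorial_succ]
  push_cast
  field_simp
  ring

/-- The partial sums of the terms obtained by applying the operator telescope. -/
theorem sum_PkCoeff_telescope {k n : ℕ} (hn : n < k) (ρ : ℝ) :
    ∑ i ∈ Finset.range (n + 1), PkCoeff k i *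
        ((((i : ℝ) + 1) ^ 2 - (k : ℝ) ^ 2) * ρ ^ (i + 1) + (i + 1) * i * ρ ^ i) =
      PkCoeff k n * (((n : ℝ) + 1) ^ 2 - (k : ℝ) ^ 2) * ρ ^ (n + 1) := by
  induction n with
  | zero => simp; ring
  | succ n ih =>
    rw [Finset.sum_range_succ, ih (by omega)]
    push_cast
    linear_combination ρ ^ (n + 1) * PkCoeff_succ hn

theorem deriv_Pk (k : ℕ) :
    deriv (Pk k) = fun ρ => -∑ i ∈ Finset.range k, PkCoeff k i * ((i + 1) * ρ ^ i) := by
  funext ρ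
  rw [show Pk k = fun ρ => _ from funext (Pk_eq_sum_range k)]
  refine (HasDerivAt.fun_sum fun i _ => ?_).neg.deriv
  simpa using (hasDerivAt_pow (i + 1) ρ).const_mul (PkCoeff k i)

theorem deriv_deriv_Pk (k : ℕ) (ρ : ℝ) :
    deriv (deriv (Pk k)) ρ =
      -∑ i ∈ Finset.range k, PkCoeff k i * ((i + 1) * (i * ρ ^ (i - 1))) := by
  rw [deriv_Pk]
  refine (HasDerivAt.fun_sum fun i _ => ?_).neg.deriv
  exact ((hasDerivAt_pow i ρ).const_mul _).const_mul _

theorem Pk_ode {k : ℕ} (hk : 1 ≤ k) (ρ : ℝ) :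
    ρ * (ρ + 1) * deriv (deriv (Pk k)) ρ + ρ * deriv (Pk k) ρ - (k : ℝ) ^ 2 * Pk k ρ = 0 := by
  obtain ⟨n, rfl⟩ := Nat.exists_eq_add_of_le' hk
  have h := sum_PkCoeff_telescope (Nat.lt_succ_self n) ρ
  rw [← Nat.cast_add_one n, sub_self, mul_zero, zero_mul] at h
  have hsplit : ∑ i ∈ Finset.range (n + 1), PkCoeff (n + 1) i *
        ((((i : ℝ) + 1) ^ 2 - ((n + 1 : ℕ) : ℝ) ^ 2) * ρ ^ (i + 1) + (i + 1) * i * ρ ^ i) =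
      ρ * (ρ + 1) * ∑ i ∈ Finset.range (n + 1),
          PkCoeff (n + 1) i * ((i + 1) * (i * ρ ^ (i - 1)))
        + ρ * ∑ i ∈ Finset.range (n + 1), PkCoeff (n + 1) i * ((i + 1) * ρ ^ i)
        - ((n + 1 : ℕ) : ℝ) ^ 2 * ∑ i ∈ Finset.range (n + 1), PkCoeff (n + 1) i * ρ ^ (i + 1) := by
    simp only [Finset.mul_sum, ← Finset.sum_add_distrib, ← Finset.sum_sub_distrib]
    refine Finset.sum_congr rfl fun i _ => ?_
    rcases i with _ | i
    · push_cast
      ring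
    · rw [Nat.add_sub_cancel]
      push_cast
      ring
  rw [deriv_deriv_Pk, deriv_Pk, Pk_eq_sum_range]
  linear_combination hsplit - h

theorem deriv_deriv_cos_mul_add (a b t : ℝ) :
    deriv (deriv fun s => cos (a * (s + b))) t = -a ^ 2 * cos (a * (t + b)) := by
  have hlin (s : ℝ) : HasDerivAt (fun s => a * (s + b)) a s := by
    simpa using ((hasDerivAt_id s).add_const b).const_mul a
  rw [funext fun s => (hlin s).cos.deriv]
  refine ((hlin t).sin.neg.mul_const a).deriv.trans ?_
  ring

/-- The polynomial `P_k` satisfies `ρ(ρ+1)P_k'' + ρP_k' − k²P_k = 0` on `ℝ`,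
and hence `Z(ρ,ψ) = P_k(ρ)cos(k(ψ+ψ₀))` solves equation (5.11) on all of `ℝ²`. -/
theorem statement18 (k : ℕ) (hk : 1 ≤ k) (ψ₀ : ℝ) :
    (∀ ρ : ℝ,
      ρ * (ρ + 1) * deriv (deriv (Pk k)) ρ + ρ * deriv (Pk k) ρ
        - (k : ℝ) ^ 2 * Pk k ρ = 0) ∧
    (∀ q : ℝ × ℝ,
      q.1 * (q.1 + 1) *
          pdx (pdx (fun p => Pk k p.1 * Real.cos (k * (p.2 + ψ₀)))) q
        + q.1 * pdx (fun p => Pk k p.1 * Real.cos (k * (p.2 + ψ₀))) q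
        + pdy (pdy (fun p => Pk k p.1 * Real.cos (k * (p.2 + ψ₀)))) q = 0) := by
  refine ⟨Pk_ode hk, fun q => ?_⟩
  simp only [pdx, pdy, deriv_mul_const_field, deriv_const_mul_field, deriv_deriv_cos_mul_add]
  linear_combination cos (k * (q.2 + ψ₀)) * Pk_ode hk q.1
end
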